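/- arXiv:2206.12457 — 3 statements merged into one kernel-verified Lean document; each statement's English description precedes it below -/
import Mathlib

section
/- Let $X$ and $Y$ be independent random variables with common distribution function $F$, and let $\psi$ be a measurable function with $E(|\psi(Y)|^p) < \infty$ for some $p>1$. Then $\left\{E\left(\left|\frac{E(\psi(Y)\mathbf{1}_{[Y\le X]}\mid X)}{F(X)}\right|^p\right)\right\}^{1/p} \le \frac{p}{p-1}\left\{E(|\psi(Y)|^p)\right\}^{1/p}$. -/
open MeasureTheory Set ENNReal ProbabilityTheory

/-- one-sided maximal average -/
noncomputable def hardyMax (μ ν : Measure ℝ) (y : ℝ) : ℝ≥0∞ :=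
  ⨆ x : Ici y, ν (Iic x.1) / μ (Iic x.1)

lemma hardyMax_antitone (μ ν : Measure ℝ) : Antitone (hardyMax μ ν) := by
  intro a b hab
  exact iSup_le fun x => le_iSup (fun x : Ici a => ν (Iic x.1) / μ (Iic x.1)) ⟨x.1, hab.trans x.2⟩

lemma hardyMax_weak (μ ν : Measure ℝ) (t : ℝ≥0∞) :
    t * μ {y | t < hardyMax μ ν y} ≤ ν {y | t < hardyMax μ ν y} := by
  set E := {y | t < hardyMax μ ν y} with hE
  have key : ∀ q ∈ E, t * μ (Iic q) ≤ ν E := by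
    intro q hq
    obtain ⟨x, hx⟩ := lt_iSup_iff.1 (show t < hardyMax μ ν q from hq)
    have hsub : Iic x.1 ⊆ E := by
      intro z hz
      exact lt_of_lt_of_le hx (le_iSup (fun x : Ici z => ν (Iic x.1) / μ (Iic x.1)) ⟨x.1, hz⟩)
    calc t * μ (Iic q) ≤ t * μ (Iic x.1) := by gcongr; exact x.2
      _ ≤ ν (Iic x.1) := ENNReal.mul_le_of_le_div hx.le
      _ ≤ ν E := measure_mono hsub
  have lower : ∀ q ∈ E, Iic q ⊆ E := fun q hq z hz =>
    lt_of_lt_of_le hq (hardyMax_antitone μ ν hz)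
  by_cases hmax : ∃ m ∈ E, ∀ y ∈ E, y ≤ m
  · obtain ⟨m, hm, h⟩ := hmax
    have : E = Iic m := Subset.antisymm (fun y hy => h y hy) (lower m hm)
    calc t * μ E = t * μ (Iic m) := by rw [← this]
      _ ≤ _ := key m hm
  · push Not at hmax
    have hU : E = ⋃ q : {q : ℚ // (q : ℝ) ∈ E}, Iic (q.1 : ℝ) := by
      refine Subset.antisymm (fun y hy => ?_) (iUnion_subset fun q => lower _ q.2)
      obtain ⟨z, hz, hyz⟩ := hmax y hy
      obtain ⟨q, h1, h2⟩ := exists_rat_btwn hyz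
      exact mem_iUnion.2 ⟨⟨q, lower z hz h2.le⟩, h1.le⟩
    have hd : Monotone (fun q : {q : ℚ // (q : ℝ) ∈ E} => Iic (q.1 : ℝ)) := by
      intro a b hab
      exact Iic_subset_Iic.2 (by exact_mod_cast hab)
    have : μ E = ⨆ q : {q : ℚ // (q : ℝ) ∈ E}, μ (Iic (q.1 : ℝ)) := by
      conv_lhs => rw [hU]
      exact hd.directed_le.measure_iUnion
    rw [this, ENNReal.mul_iSup]
    exact iSup_le fun q => key _ q.2

/-- Doob type lemma: weak type gives strong type, for bounded real functions -/
lemma doob_real {α : Type*} [MeasurableSpace α] (μ : Measure α) [IsFiniteMeasure μ]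
    (f : α → ℝ≥0∞) (hf : Measurable f) (g : α → ℝ) (hg : Measurable g) (hg0 : ∀ a, 0 ≤ g a)
    (N : ℝ) (hN : ∀ a, g a ≤ N) (p : ℝ) (hp : 1 < p)
    (hw : ∀ t : ℝ, 0 < t → ENNReal.ofReal t * μ {a | t < g a} ≤ μ.withDensity f {a | t < g a}) :
    (∫⁻ a, ENNReal.ofReal (g a ^ p) ∂μ) ^ (1 / p) ≤
      ENNReal.ofReal (p / (p - 1)) * (∫⁻ a, f a ^ p ∂μ) ^ (1 / p) := by
  have hp0 : 0 < p := by linarith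
  have hp1 : 0 < p - 1 := by linarith
  set I := ∫⁻ a, ENNReal.ofReal (g a ^ p) ∂μ with hI
  have hIfin : I ≠ ⊤ := by
    refine ne_of_lt (lt_of_le_of_lt (lintegral_mono (g := fun _ => ENNReal.ofReal (N ^ p)) ?_) ?_)
    · intro a
      exact ENNReal.ofReal_le_ofReal (Real.rpow_le_rpow (hg0 a) (hN a) hp0.le)
    · simp [ENNReal.mul_lt_top]
  have h1 : I ≤ ENNReal.ofReal (p / (p - 1)) *
      ∫⁻ a, ENNReal.ofReal (g a ^ (p - 1)) ∂(μ.withDensity f) := by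
    rw [hI, lintegral_rpow_eq_lintegral_meas_lt_mul μ (.of_forall hg0) hg.aemeasurable hp0,
      lintegral_rpow_eq_lintegral_meas_lt_mul _ (.of_forall hg0) hg.aemeasurable hp1,
      ← mul_assoc, ← ENNReal.ofReal_mul (by positivity), div_mul_cancel₀ _ hp1.ne']
    gcongr 1
    refine setLIntegral_mono' measurableSet_Ioi fun t ht => ?_
    have ht : 0 < t := ht
    have : t ^ (p - 1) = t * t ^ (p - 1 - 1) := by
      rw [Real.rpow_sub_one ht.ne' (p - 1)]; field_simp
    rw [this, ENNReal.ofReal_mul ht.le, ← mul_assoc, mul_comm (μ _)]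
    gcongr
    exact hw t ht
  have hpq : p.HolderConjugate (p / (p - 1)) := Real.HolderConjugate.conjExponent hp
  have h2 : ∫⁻ a, ENNReal.ofReal (g a ^ (p - 1)) ∂(μ.withDensity f) ≤
      (∫⁻ a, f a ^ p ∂μ) ^ (1 / p) * I ^ (1 / (p / (p - 1))) := by
    have hm : Measurable fun a => ENNReal.ofReal (g a ^ (p - 1)) := by fun_prop
    rw [lintegral_withDensity_eq_lintegral_mul μ hf hm]
    refine (ENNReal.lintegral_mul_le_Lp_mul_Lq μ hpq hf.aemeasurable hm.aemeasurable).trans ?_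
    gcongr 3
    refine (lintegral_congr fun a => ?_).le
    rw [ENNReal.ofReal_rpow_of_nonneg (Real.rpow_nonneg (hg0 a) _) (by positivity),
      ← Real.rpow_mul (hg0 a), mul_div_cancel₀ _ hp1.ne']
  rcases eq_or_ne I 0 with h0 | h0
  · rw [h0, ENNReal.zero_rpow_of_pos (by positivity)]; exact zero_le
  have h3 := h1.trans (mul_le_mul_right h2 _)
  have hs : I = I ^ (1 / p) * I ^ (1 / (p / (p - 1))) := by
    rw [← ENNReal.rpow_add _ _ h0 hIfin]
    conv_lhs => rw [← ENNReal.rpow_one I]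
    congr 1
    field_simp; ring
  have hc0 : I ^ (1 / (p / (p - 1))) ≠ 0 := by
    simp [ENNReal.rpow_eq_zero_iff, h0, hIfin]
  have hct : I ^ (1 / (p / (p - 1))) ≠ ⊤ := by
    simp [ENNReal.rpow_eq_top_iff, h0, hIfin]
  rw [← mul_assoc] at h3
  conv_lhs at h3 => rw [hs]
  exact (ENNReal.mul_le_mul_iff_left hc0 hct).1 h3

lemma doob_hardy (μ : Measure ℝ) [IsFiniteMeasure μ] (f : ℝ → ℝ≥0∞) (hf : Measurable f)
    (p : ℝ) (hp : 1 < p) :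
    (∫⁻ x, hardyMax μ (μ.withDensity f) x ^ p ∂μ) ^ (1 / p) ≤
      ENNReal.ofReal (p / (p - 1)) * (∫⁻ a, f a ^ p ∂μ) ^ (1 / p) := by
  have hp0 : 0 < p := by linarith
  set M := hardyMax μ (μ.withDensity f) with hM
  have hMm : Measurable M := (hardyMax_antitone _ _).measurable
  have hsup : ∀ x, M x ^ p = ⨆ n : ℕ, (min (M x) n) ^ p := by
    intro x
    have : M x = ⨆ n : ℕ, min (M x) n := by
      have h : (⨆ n : ℕ, (n : ℝ≥0∞)) = ⊤ := ENNReal.iSup_natCast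
      rw [← inf_iSup_eq (M x) (fun n : ℕ => (n : ℝ≥0∞)), h, inf_top_eq]
    conv_lhs => rw [this]
    exact (ENNReal.orderIsoRpow p hp0).map_iSup _
  simp_rw [hsup]
  rw [lintegral_iSup (fun n => by fun_prop)]
  · rw [one_div, ENNReal.rpow_inv_le_iff hp0]
    refine iSup_le fun n => ?_
    rw [← ENNReal.rpow_inv_le_iff hp0, ← one_div]
    have hfin : ∀ x, min (M x) n ≠ ⊤ := fun x => ne_top_of_le_ne_top (by simp) (min_le_right _ _)
    have := doob_real μ f hf (fun x => (min (M x) n).toReal) (by fun_prop) (fun _ => toReal_nonneg)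
      n (fun x => by simpa using ENNReal.toReal_mono (by simp) (min_le_right (M x) n)) p hp ?_
    · convert this using 4 with x
      rw [← ENNReal.ofReal_rpow_of_nonneg toReal_nonneg hp0.le, ENNReal.ofReal_toReal (hfin x)]
    · intro t ht
      by_cases htn : t < n
      · have : {a | t < (min (M a) n).toReal} = {a | ENNReal.ofReal t < M a} := by
          ext a
          simp only [mem_ofPred_eq]
          rw [← ENNReal.ofReal_lt_iff_lt_toReal ht.le (hfin a), lt_min_iff]
          refine and_iff_left ?_
          rw [ENNReal.ofReal_lt_iff_lt_toReal ht.le (by simp)]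
          simpa using htn
        rw [this]
        exact hardyMax_weak _ _ _
      · have : {a | t < (min (M a) n).toReal} = ∅ := by
          ext a
          simp only [mem_ofPred_eq, mem_empty_iff_false, iff_false, not_lt]
          exact le_trans (by simpa using ENNReal.toReal_mono (by simp) (min_le_right (M a) n))
            (not_lt.1 htn)
        simp [this]
  · intro a b hab x
    dsimp only
    gcongr

/-- Probability theoretic Hardy inequality (with `α = 0`):
`{E(|E(ψ(Y)1_{Y≤X} | X) / F(X)|^p)}^{1/p} ≤ p/(p-1) {E(|ψ(Y)|^p)}^{1/p}`. -/
theorem probability_hardy {Ω : Type*} [MeasurableSpace Ω] (P : Measure Ω)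
    [IsProbabilityMeasure P] (X Y : Ω → ℝ) (hX : Measurable X) (hY : Measurable Y)
    (hindep : IndepFun X Y P) (hid : Measure.map X P = Measure.map Y P)
    (ψ : ℝ → ℝ) (hψ : Measurable ψ) (p : ℝ) (hp : 1 < p)
    (hmom : ∫⁻ ω, ENNReal.ofReal (|ψ (Y ω)| ^ p) ∂P < ⊤) :
    (∫⁻ ω, ENNReal.ofReal
        (|(P[fun ω' => if Y ω' ≤ X ω' then ψ (Y ω') else 0 |
            MeasurableSpace.comap X inferInstance]) ω /
          (Measure.map X P (Iic (X ω))).toReal| ^ p) ∂P) ^ (1 / p)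
      ≤ ENNReal.ofReal (p / (p - 1)) *
        (∫⁻ ω, ENNReal.ofReal (|ψ (Y ω)| ^ p) ∂P) ^ (1 / p) := by
  have hp0 : 0 < p := by linarith
  set μ := Measure.map X P with hμ
  have : IsProbabilityMeasure μ := Measure.isProbabilityMeasure_map hX.aemeasurable
  let f : ℝ → ℝ≥0∞ := fun y => ‖ψ y‖ₑ
  have hf : Measurable f := hψ.enorm
  have hfp : ∀ y, ENNReal.ofReal (|ψ y| ^ p) = f y ^ p := fun y => by
    rw [← ENNReal.ofReal_rpow_of_nonneg (abs_nonneg _) hp0.le, ← Real.enorm_eq_ofReal_abs]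
  have hR : ∫⁻ ω, ENNReal.ofReal (|ψ (Y ω)| ^ p) ∂P = ∫⁻ y, f y ^ p ∂μ := by
    rw [hid, lintegral_map (by fun_prop) hY]
    exact lintegral_congr fun ω => hfp _
  -- integrability
  have hint : Integrable (fun ω => ψ (Y ω)) P := by
    have hmem : MemLp (fun ω => ψ (Y ω)) (ENNReal.ofReal p) P := by
      refine ⟨(hψ.comp hY).aestronglyMeasurable, ?_⟩
      rw [eLpNorm_lt_top_iff_lintegral_rpow_enorm_lt_top (by simpa using hp0) (by simp),
        ENNReal.toReal_ofReal hp0.le]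
      simp_rw [hfp] at hmom
      exact hmom
    exact hmem.integrable (by simpa using hp.le)
  let φ : ℝ × ℝ → ℝ := fun z => if z.2 ≤ z.1 then ψ z.2 else 0
  have hφ : Measurable φ :=
    Measurable.ite (measurableSet_le measurable_snd measurable_fst) (by fun_prop) (by fun_prop)
  have hφint : Integrable (fun ω => φ (X ω, Y ω)) P := by
    refine hint.mono (hφ.comp (hX.prodMk hY)).aestronglyMeasurable (.of_forall fun ω => ?_)
    simp only [φ]
    split_ifs <;> simp
  have hce := condExp_prod_ae_eq_integral_condDistrib (μ := P) hX hY.aemeasurable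
    hφ.stronglyMeasurable hφint
  have hcd : condDistrib Y X P =ᵐ[μ] Kernel.const ℝ μ := by
    refine condDistrib_ae_eq_of_measure_eq_compProd X hY.aemeasurable ?_
    rw [Measure.compProd_const, hindep.map_prod_eq_prod_map_map hX.aemeasurable hY.aemeasurable,
      ← hid]
  have hcd' := ae_of_ae_map hX.aemeasurable hcd
  have hL : ∫⁻ ω, ENNReal.ofReal
        (|(P[fun ω' => if Y ω' ≤ X ω' then ψ (Y ω') else 0 |
            MeasurableSpace.comap X inferInstance]) ω /
          (μ (Iic (X ω))).toReal| ^ p) ∂P ≤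
      ∫⁻ x, hardyMax μ (μ.withDensity f) x ^ p ∂μ := by
    have hm : Measurable (hardyMax μ (μ.withDensity f)) := (hardyMax_antitone _ _).measurable
    rw [hμ, lintegral_map (by fun_prop) hX, ← hμ]
    refine lintegral_mono_ae ?_
    filter_upwards [hce, hcd'] with ω h1 h2
    have h1 : (P[fun ω' => if Y ω' ≤ X ω' then ψ (Y ω') else 0 |
            MeasurableSpace.comap X inferInstance]) ω = ∫ y, φ (X ω, y) ∂μ := by
      rw [h2] at h1
      exact h1
    rw [h1, ← ENNReal.ofReal_rpow_of_nonneg (abs_nonneg _) hp0.le]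
    gcongr
    set x := X ω
    refine le_trans ?_ (le_iSup (fun z : Ici x => (μ.withDensity f) (Iic z.1) / μ (Iic z.1))
      ⟨x, self_mem_Ici⟩)
    dsimp only
    rcases eq_or_ne (μ (Iic x)) 0 with h0 | h0
    · simp [h0]
    have hpos : 0 < (μ (Iic x)).toReal := ENNReal.toReal_pos h0 (measure_ne_top _ _)
    rw [abs_div, abs_of_pos hpos, ENNReal.ofReal_div_of_pos hpos,
      ENNReal.ofReal_toReal (measure_ne_top _ _), ← Real.enorm_eq_ofReal_abs]
    gcongr
    refine (enorm_integral_le_lintegral_enorm _).trans ?_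
    rw [withDensity_apply _ measurableSet_Iic, ← lintegral_indicator measurableSet_Iic]
    refine lintegral_mono fun y => ?_
    by_cases hy : y ≤ x
    · simp [φ, hy, f]
    · simp [φ, hy]
  rw [hR]
  refine le_trans ?_ (doob_hardy μ f hf p hp)
  gcongr
end

section
/- Let $X$ and $Y$ be independent random variables with common distribution function $F$, let $p>1$, and let $\psi$ be a measurable function, not identically zero, with $E(|\psi(Y)|^p)<\infty$. Let $\alpha\in[0,1]$ be the unique root of $E(|\psi(Y)|)(p-1+\alpha) - p\{E(|\psi(Y)|^p)\}^{1/p}\alpha^{1/p} = 0$. Then $\left\{E\left(\left|\frac{E(\psi(Y)\mathbf{1}_{[Y\le X]}\mid X)}{F(X)}\right|^p\right)\right\}^{1/p} \le \frac{p}{p-1+\alpha}\left\{E(|\psi(Y)|^p)\right\}^{1/p}$. -/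
open MeasureTheory Set ENNReal ProbabilityTheory
open Filter Topology

lemma young1 {p : ℝ} (hp : 1 < p) {c v : ℝ} (hc : 0 ≤ c) (hv : 0 ≤ v) :
    p * c ^ (p - 1) * v ≤ (p - 1) * c ^ p + v ^ p := by
  have hp0 : 0 < p := by linarith
  have hpq : p.HolderConjugate (p / (p - 1)) := Real.HolderConjugate.conjExponent hp
  have h := Real.young_inequality_of_nonneg hv (Real.rpow_nonneg hc (p - 1)) hpq
  rw [← Real.rpow_mul hc, mul_div_cancel₀ _ (by linarith : p - 1 ≠ 0)] at h
  have : p * (v ^ p / p + c ^ p / (p / (p - 1))) = (p - 1) * c ^ p + v ^ p := by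
    have : p - 1 ≠ 0 := by linarith
    field_simp
    ring
  nlinarith [mul_le_mul_of_nonneg_left h hp0.le]

lemma young2 {p : ℝ} (hp : 1 < p) {c v l : ℝ} (hc : 0 ≤ c) (hv : 0 ≤ v) (hl : 0 < l) :
    p * c ^ (p - 1) * v ≤ (p - 1) * l * c ^ p + l ^ (1 - p) * v ^ p := by
  have h := young1 hp (mul_nonneg hl.le hc) hv
  rw [Real.mul_rpow hl.le hc, Real.mul_rpow hl.le hc] at h
  have h1 : l ^ (1 - p) * l ^ (p - 1) = 1 := by
    rw [← Real.rpow_add hl]; simp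
  have h2 : l ^ (1 - p) * l ^ p = l := by
    rw [← Real.rpow_add hl]; simp
  have h3 := mul_le_mul_of_nonneg_left h (Real.rpow_nonneg hl.le (1 - p))
  calc p * c ^ (p - 1) * v = (l ^ (1 - p) * l ^ (p - 1)) * (p * c ^ (p - 1) * v) := by
        rw [h1]; ring
    _ = l ^ (1 - p) * (p * (l ^ (p - 1) * c ^ (p - 1)) * v) := by ring
    _ ≤ _ := h3
    _ = (p - 1) * (l ^ (1 - p) * l ^ p) * c ^ p + l ^ (1 - p) * v ^ p := by ring
    _ = _ := by rw [h2]

lemma rpow_split {p : ℝ} (hp : 1 < p) {c : ℝ} (hc : 0 ≤ c) : c ^ (p - 1) * c = c ^ p := by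
  have := Real.rpow_add_one' hc (y := p - 1) (by linarith)
  rw [← this]; congr 1; ring

lemma seq_bound {p l : ℝ} (hp : 1 < p) (F G D H : ℕ → ℝ)
    (hF0 : F 0 = 0) (hD0 : D 0 = 0) (hFn : ∀ j, 0 ≤ F j) (hH : ∀ j, 0 ≤ H j)
    (hFH : ∀ j, F j * H j = G j)
    (hY : ∀ j, ∀ c : ℝ, 0 ≤ c → p * c ^ (p - 1) * (G (j + 1) - G j) ≤
      (p - 1) * l * c ^ p * (F (j + 1) - F j) + l ^ (1 - p) * (D (j + 1) - D j)) (n : ℕ) :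
    (p - 1) * (1 - l) * ∑ j ∈ Finset.range n, (F (j + 1) - F j) * H (j + 1) ^ p
      + F n * H n ^ p ≤ l ^ (1 - p) * D n := by
  induction n with
  | zero => simp [hF0, hD0]
  | succ n ih =>
    rw [Finset.sum_range_succ]
    have h1 := mul_le_mul_of_nonneg_left (young1 hp (hH (n + 1)) (hH n)) (hFn n)
    have h2 := hY n (H (n + 1)) (hH _)
    have h3 := rpow_split hp (hH (n + 1))
    rw [← hFH, ← hFH] at h2
    have h4 : p * H (n+1) ^ (p - 1) * (F (n+1) * H (n+1) - F n * H n)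
      = p * F (n+1) * H (n+1) ^ p - F n * (p * H (n+1) ^ (p - 1) * H n) := by
      rw [← h3]; ring
    rw [h4] at h2
    linarith

/-- right continuity via dominated convergence -/
lemma tendsto_setInt (μ : Measure ℝ) {f : ℝ → ℝ} (hf : Integrable f μ) {s : Set ℝ}
    {S : ℕ → Set ℝ} (hS : ∀ n, MeasurableSet (S n)) (hs : MeasurableSet s)
    (h : ∀ y, ∀ᶠ n in atTop, (y ∈ S n ↔ y ∈ s)) :
    Tendsto (fun n => ∫ y in S n, f y ∂μ) atTop (𝓝 (∫ y in s, f y ∂μ)) := by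
  simp_rw [← integral_indicator (hS _), ← integral_indicator hs]
  refine tendsto_integral_of_dominated_convergence (fun y => ‖f y‖) ?_ hf.norm ?_ ?_
  · intro n; exact (hf.indicator (hS n)).aestronglyMeasurable
  · intro n; exact Eventually.of_forall fun y => norm_indicator_le_norm_self _ _
  · refine Eventually.of_forall fun y => ?_
    refine tendsto_const_nhds.congr' ?_
    filter_upwards [h y] with n hn
    by_cases hy : y ∈ s
    · simp [hy, hn.2 hy]
    · simp [hy, mt hn.1 hy]

lemma hardy_aux (μ : Measure ℝ) [IsProbabilityMeasure μ] {f : ℝ → ℝ} (hf0 : ∀ y, 0 ≤ f y)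
    (hf : Integrable f μ) {p : ℝ} (hp : 1 < p) (hfp : Integrable (fun y => f y ^ p) μ)
    {l : ℝ} (hl : 0 < l) (hl1 : l < 1) :
    ∫⁻ x, ENNReal.ofReal (((∫ y in Iic x, f y ∂μ) / μ.real (Iic x)) ^ p) ∂μ ≤
      ENNReal.ofReal ((l ^ (1 - p) * (∫ y, f y ^ p ∂μ) - (∫ y, f y ∂μ) ^ p) /
        ((p - 1) * (1 - l))) := by
  have hp0 : 0 < p := by linarith
  set Hf : ℝ → ℝ := fun x => (∫ y in Iic x, f y ∂μ) / μ.real (Iic x) with hHf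
  have hHf0 : ∀ x, 0 ≤ Hf x := fun x =>
    div_nonneg (integral_nonneg fun y => hf0 y) measureReal_nonneg
  have hFH : ∀ x, μ.real (Iic x) * Hf x = ∫ y in Iic x, f y ∂μ := by
    intro x
    by_cases h : μ.real (Iic x) = 0
    · rw [h, zero_mul, setIntegral_measure_zero]
      exact (measureReal_eq_zero_iff).1 h
    · simp only [hHf]; field_simp
  have hreal : ∀ s : Set ℝ, μ.real s = ∫ y in s, (1 : ℝ) ∂μ := by intro s; simp
  -- cells
  let idx : ℕ → ℝ → ℕ := fun k x => ⌈(x + k) * (k + 1)⌉₊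
  let a : ℕ → ℕ → ℝ := fun k j => -k + j / (k + 1)
  have hidx : ∀ k j x, idx k x ≤ j ↔ x ≤ a k j := by
    intro k j x
    have hk : (0 : ℝ) < k + 1 := by positivity
    simp only [idx, a, Nat.ceil_le]
    rw [← le_div_iff₀ hk]
    constructor <;> intro h <;> linarith
  have hidxm : ∀ k, Measurable (idx k) := by
    intro k; exact Nat.measurable_ceil.comp (by fun_prop)
  let S : ℕ → ℕ → Set ℝ := fun k j => {x | idx k x < j}
  have hSm : ∀ k j, MeasurableSet (S k j) := fun k j => (hidxm k) measurableSet_Iio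
  have hSsucc : ∀ k j, S k (j + 1) = Iic (a k j) := by
    intro k j; ext x; simp only [S, mem_ofPred_eq, mem_Iic, ← hidx, Nat.lt_succ_iff]
  let C : ℕ → ℕ → Set ℝ := fun k j => {x | idx k x = j}
  have hCm : ∀ k j, MeasurableSet (C k j) := fun k j => (hidxm k) (measurableSet_singleton j)
  have hunion : ∀ k j, S k (j + 1) = S k j ∪ C k j := by
    intro k j; ext x; simp only [S, C, mem_ofPred_eq, mem_union]; omega
  have hdisj : ∀ k j, Disjoint (S k j) (C k j) := by
    intro k j; rw [Set.disjoint_left]; intro x h1 h2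
    simp only [S, C, mem_ofPred_eq] at h1 h2; omega
  have hdiff : ∀ k j (g : ℝ → ℝ), Integrable g μ →
      (∫ y in S k (j+1), g y ∂μ) - ∫ y in S k j, g y ∂μ = ∫ y in C k j, g y ∂μ := by
    intro k j g hg
    rw [hunion, setIntegral_union (hdisj k j) (hCm k j) hg.integrableOn hg.integrableOn]
    ring
  let N : ℕ → ℕ := fun k => 2 * k * (k + 1) + 1
  have hSN : ∀ k, S k (N k) = Iic (k : ℝ) := by
    intro k; simp only [N]; rw [hSsucc]; congr 1
    simp only [a]; push_cast; field_simp; ring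
  -- the finite bound
  have hfin : ∀ k, (p - 1) * (1 - l) *
      ∑ j ∈ Finset.range (N k), μ.real (C k j) * Hf (a k j) ^ p
      + μ.real (Iic (k : ℝ)) * Hf k ^ p ≤ l ^ (1 - p) * ∫ y, f y ^ p ∂μ := by
    intro k
    have hCreal : ∀ j, μ.real (Iic (a k j)) - μ.real (S k j) = μ.real (C k j) := by
      intro j
      rw [← hSsucc, hreal, hreal, hreal, hdiff k j _ (integrable_const _)]
    have hb := seq_bound (l := l) hp (fun j => ∫ y in S k j, (1 : ℝ) ∂μ)
      (fun j => ∫ y in S k j, f y ∂μ) (fun j => ∫ y in S k j, f y ^ p ∂μ)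
      (fun j => (∫ y in S k j, f y ∂μ) / μ.real (S k j))
      (by simp [S]) (by simp [S])
      (fun j => integral_nonneg fun y => zero_le_one)
      (fun j => div_nonneg (integral_nonneg fun y => hf0 y) measureReal_nonneg)
      (by
        intro j
        cases j with
        | zero => simp [S]
        | succ j => simp only [hSsucc, ← hreal]; exact hFH _)
      (by
        intro j c hc
        rw [hdiff k j f hf, hdiff k j _ hfp, hdiff k j _ (integrable_const _),
          ← integral_const_mul, ← integral_const_mul, ← integral_const_mul, ← integral_add]
        · refine integral_mono (hf.const_mul _).integrableOn ?_ ?_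
          · exact ((integrable_const _).add (hfp.const_mul _)).integrableOn
          · intro y
            have := young2 hp hc (hf0 y) hl
            simpa using this
        · exact (integrable_const _)
        · exact (hfp.const_mul _).integrableOn) (N k)
    simp only [← hreal, hSN, hSsucc, hCreal] at hb
    refine hb.trans ?_
    refine mul_le_mul_of_nonneg_left ?_ (Real.rpow_nonneg hl.le _)
    exact setIntegral_le_integral hfp (Eventually.of_forall fun y => Real.rpow_nonneg (hf0 y) _)
  -- step functions
  let φ : ℕ → ℝ → ℝ≥0∞ := fun k x => ∑ j ∈ Finset.range (N k),
    (C k j).indicator (fun _ => ENNReal.ofReal (Hf (a k j) ^ p)) x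
  have hφm : ∀ k, Measurable (φ k) := fun k =>
    Finset.measurable_fun_sum _ fun j _ => measurable_const.indicator (hCm k j)
  have hφint : ∀ k, ∫⁻ x, φ k x ∂μ =
      ENNReal.ofReal (∑ j ∈ Finset.range (N k), μ.real (C k j) * Hf (a k j) ^ p) := by
    intro k
    simp only [φ]
    rw [lintegral_finsetSum _ fun j _ => measurable_const.indicator (hCm k j),
      ENNReal.ofReal_sum_of_nonneg
        (fun j _ => mul_nonneg measureReal_nonneg (Real.rpow_nonneg (hHf0 _) _))]
    refine Finset.sum_congr rfl fun j _ => ?_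
    rw [lintegral_indicator_const (hCm k j), ENNReal.ofReal_mul measureReal_nonneg,
      ofReal_measureReal, mul_comm]
  have hc0 : 0 < (p - 1) * (1 - l) := mul_pos (by linarith) (by linarith)
  have hφle : ∀ k, ∫⁻ x, φ k x ∂μ ≤ ENNReal.ofReal ((l ^ (1 - p) * (∫ y, f y ^ p ∂μ)
      - μ.real (Iic (k : ℝ)) * Hf k ^ p) / ((p - 1) * (1 - l))) := by
    intro k
    rw [hφint]
    refine ENNReal.ofReal_le_ofReal ?_
    rw [le_div_iff₀ hc0]
    linarith [hfin k]
  -- limits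
  have hlimk : ∀ g : ℝ → ℝ, Integrable g μ →
      Tendsto (fun k : ℕ => ∫ y in Iic (k : ℝ), g y ∂μ) atTop (𝓝 (∫ y, g y ∂μ)) := by
    intro g hg
    rw [← setIntegral_univ]
    refine tendsto_setInt μ hg (fun _ => measurableSet_Iic) MeasurableSet.univ fun y => ?_
    filter_upwards [eventually_ge_atTop ⌈y⌉₊] with k hk
    simpa using (Nat.ceil_le.1 hk)
  have hF1 : Tendsto (fun k : ℕ => μ.real (Iic (k : ℝ))) atTop (𝓝 1) := by
    have := hlimk (fun _ => 1) (integrable_const _)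
    simpa using this
  have hGm := hlimk f hf
  have hlim : Tendsto (fun k : ℕ => ENNReal.ofReal ((l ^ (1 - p) * (∫ y, f y ^ p ∂μ)
      - μ.real (Iic (k : ℝ)) * Hf k ^ p) / ((p - 1) * (1 - l)))) atTop
      (𝓝 (ENNReal.ofReal ((l ^ (1 - p) * (∫ y, f y ^ p ∂μ) - (∫ y, f y ∂μ) ^ p) /
        ((p - 1) * (1 - l))))) := by
    refine ENNReal.tendsto_ofReal (Tendsto.div_const (Tendsto.sub tendsto_const_nhds ?_) _)
    have h1 : Tendsto (fun k : ℕ => Hf k) atTop (𝓝 (∫ y, f y ∂μ)) := by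
      have h := hGm.div hF1 one_ne_zero
      rw [div_one] at h
      exact h
    simpa using hF1.mul (h1.rpow_const (p := p) (Or.inr hp0.le))
  -- pointwise lower bound
  have hpt : ∀ x, ENNReal.ofReal (Hf x ^ p) ≤ liminf (fun k => φ k x) atTop := by
    intro x
    by_cases hx : μ.real (Iic x) = 0
    · simp [hHf, hx, Real.zero_rpow hp0.ne']
    have hge : ∀ k, x ≤ a k (idx k x) := fun k => (hidx k _ x).1 le_rfl
    have hbd : ∀ᶠ k : ℕ in atTop, a k (idx k x) ≤ x + 1 / ((k : ℝ) + 1) := by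
      filter_upwards [eventually_ge_atTop ⌈-x⌉₊] with k hk
      have hk' := Nat.ceil_le.1 hk
      have hk0 : (0 : ℝ) < k + 1 := by positivity
      have := Nat.ceil_lt_add_one (a := (x + k) * ((k : ℝ) + 1))
        (mul_nonneg (by linarith) hk0.le)
      have h2 : ((idx k x : ℕ) : ℝ) / (k + 1) ≤ (x + k) + 1 / ((k : ℝ) + 1) := by
        rw [div_le_iff₀ hk0, add_mul, one_div_mul_cancel hk0.ne']
        exact this.le
      simp only [a]; linarith
    have hat : Tendsto (fun k => a k (idx k x)) atTop (𝓝 x) := by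
      refine tendsto_of_tendsto_of_tendsto_of_le_of_le' tendsto_const_nhds ?_
        (Eventually.of_forall hge) hbd
      simpa using tendsto_const_nhds.add (tendsto_one_div_add_atTop_nhds_zero_nat (𝕜 := ℝ))
    have hlx : ∀ g : ℝ → ℝ, Integrable g μ → Tendsto
        (fun k : ℕ => ∫ y in Iic (a k (idx k x)), g y ∂μ) atTop (𝓝 (∫ y in Iic x, g y ∂μ)) := by
      intro g hg
      refine tendsto_setInt μ hg (fun _ => measurableSet_Iic) measurableSet_Iic fun y => ?_
      by_cases hy : y ≤ x
      · exact Eventually.of_forall fun k => by simp [hy, hy.trans (hge k)]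
      · filter_upwards [hat.eventually_lt_const (not_le.1 hy)] with k hk
        simp [hy, hk]
    have hFx : Tendsto (fun k : ℕ => μ.real (Iic (a k (idx k x)))) atTop (𝓝 (μ.real (Iic x))) := by
      simpa using hlx (fun _ => 1) (integrable_const _)
    have hHx : Tendsto (fun k : ℕ => Hf (a k (idx k x))) atTop (𝓝 (Hf x)) :=
      (hlx f hf).div hFx hx
    have hφx : Tendsto (fun k => φ k x) atTop (𝓝 (ENNReal.ofReal (Hf x ^ p))) := by
      refine (ENNReal.tendsto_ofReal (hHx.rpow_const (p := p) (Or.inr hp0.le))).congr' ?_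
      filter_upwards [eventually_ge_atTop ⌈x⌉₊] with k hk
      have hk' : x ∈ S k (N k) := by rw [hSN]; exact Nat.ceil_le.1 hk
      simp only [φ]
      rw [Finset.sum_eq_single (idx k x)]
      · simp [C]
      · intro j _ hj
        simp [C, hj.symm]
      · intro h; exact absurd hk' (by simpa [S] using h)
    rw [hφx.liminf_eq]
  calc ∫⁻ x, ENNReal.ofReal (Hf x ^ p) ∂μ ≤ ∫⁻ x, liminf (fun k => φ k x) atTop ∂μ :=
        lintegral_mono hpt
    _ ≤ liminf (fun k => ∫⁻ x, φ k x ∂μ) atTop := lintegral_liminf_le hφm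
    _ ≤ liminf (fun k : ℕ => ENNReal.ofReal ((l ^ (1 - p) * (∫ y, f y ^ p ∂μ)
      - μ.real (Iic (k : ℝ)) * Hf k ^ p) / ((p - 1) * (1 - l)))) atTop :=
        liminf_le_liminf (Eventually.of_forall hφle)
    _ = _ := hlim.liminf_eq

lemma hardy_main (μ : Measure ℝ) [IsProbabilityMeasure μ] {f : ℝ → ℝ} (hf0 : ∀ y, 0 ≤ f y)
    (hf : Integrable f μ) {p : ℝ} (hp : 1 < p) (hfp : Integrable (fun y => f y ^ p) μ)
    {α : ℝ} (hα : α ∈ Icc (0 : ℝ) 1)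
    (hroot : (∫ y, f y ∂μ) * (p - 1 + α) - p * (∫ y, f y ^ p ∂μ) ^ (1 / p) * α ^ (1 / p) = 0) :
    ∫⁻ x, ENNReal.ofReal (((∫ y in Iic x, f y ∂μ) / μ.real (Iic x)) ^ p) ∂μ ≤
      ENNReal.ofReal ((p / (p - 1 + α)) ^ p * ∫ y, f y ^ p ∂μ) := by
  have hp0 : 0 < p := by linarith
  have hpa : 0 < p - 1 + α := by linarith [hα.1]
  set D := ∫ y, f y ^ p ∂μ with hD
  set m := ∫ y, f y ∂μ with hm
  have hD0 : 0 ≤ D := integral_nonneg fun y => Real.rpow_nonneg (hf0 y) _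
  have hm0 : 0 ≤ m := integral_nonneg hf0
  have hmp : m ^ p = (p / (p - 1 + α)) ^ p * D * α := by
    have h1 : m = (p / (p - 1 + α)) * (D ^ (1 / p) * α ^ (1 / p)) := by
      field_simp
      field_simp at hroot
      linarith
    have h2 : 0 ≤ p / (p - 1 + α) := by positivity
    rw [h1, Real.mul_rpow h2 (mul_nonneg (Real.rpow_nonneg hD0 _) (Real.rpow_nonneg hα.1 _)),
      Real.mul_rpow (Real.rpow_nonneg hD0 _) (Real.rpow_nonneg hα.1 _),
      ← Real.rpow_mul hD0, ← Real.rpow_mul hα.1, one_div_mul_cancel hp0.ne', Real.rpow_one,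
      Real.rpow_one, mul_assoc]
  rcases hα.2.lt_or_eq with h1 | h1
  · have hl : 0 < (p - 1 + α) / p := by positivity
    have hl1 : (p - 1 + α) / p < 1 := by rw [div_lt_one hp0]; linarith
    refine (hardy_aux μ hf0 hf hp hfp hl hl1).trans_eq ?_
    congr 1
    rw [← hD, ← hm, hmp]
    have h3 : ((p - 1 + α) / p) ^ (1 - p) = (p / (p - 1 + α)) ^ p * ((p - 1 + α) / p) := by
      rw [sub_eq_add_neg (1 : ℝ) p, Real.rpow_add hl, Real.rpow_one, Real.rpow_neg hl.le,
        ← Real.inv_rpow hl.le, inv_div, mul_comm]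
    rw [h3]
    have h4 : 1 - α ≠ 0 := by linarith
    have h5 : p - 1 ≠ 0 := by linarith
    have h6 : 1 - (p - 1 + α) / p = (1 - α) / p := by field_simp; ring
    rw [h6]
    field_simp
    ring
  · subst h1
    have e : p / (p - 1 + 1) = 1 := by rw [sub_add_cancel, div_self hp0.ne']
    rw [e, Real.one_rpow, one_mul] at hmp ⊢
    rw [mul_one] at hmp
    have key : ∀ s : ℝ, 1 < s → ∫⁻ x, ENNReal.ofReal (((∫ y in Iic x, f y ∂μ) /
        μ.real (Iic x)) ^ p) ∂μ ≤ ENNReal.ofReal (s ^ p * D) := by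
      intro s hs
      have hs0 : 0 < s := by linarith
      refine (hardy_aux μ hf0 hf hp hfp (inv_pos.2 hs0) (inv_lt_one_of_one_lt₀ hs)).trans ?_
      refine ENNReal.ofReal_le_ofReal ?_
      rw [← hD, ← hm, hmp]
      have hc : 0 < (p - 1) * (1 - s⁻¹) :=
        mul_pos (by linarith) (by linarith [inv_lt_one_of_one_lt₀ hs])
      rw [div_le_iff₀ hc, Real.inv_rpow hs0.le, ← Real.rpow_neg hs0.le]
      have e1 : s ^ p = s ^ (p - 1) * s := (rpow_split hp hs0.le).symm
      have e2 : s ^ p * ((p - 1) * (1 - s⁻¹)) = s ^ (p - 1) * ((p - 1) * (s - 1)) := by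
        rw [e1]; field_simp
      have e3 : 1 - (p - 1) * (s - 1) ≤ s ^ (-(p - 1)) := by
        rw [Real.rpow_def_of_pos hs0]
        have := Real.add_one_le_exp (Real.log s * -(p - 1))
        nlinarith [Real.log_le_sub_one_of_pos hs0]
      have e4 : s ^ (p - 1) * s ^ (-(p - 1)) = 1 := by
        rw [← Real.rpow_add hs0]; simp
      have e5 := mul_le_mul_of_nonneg_left e3 (Real.rpow_nonneg hs0.le (p - 1))
      have e6 : -(1 - p) = p - 1 := by ring
      rw [e6]
      have e7 : s ^ (p - 1) - 1 ≤ s ^ p * ((p - 1) * (1 - s⁻¹)) := by rw [e2]; linarith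
      nlinarith [mul_le_mul_of_nonneg_right e7 hD0]
    have ht : Tendsto (fun s : ℝ => ENNReal.ofReal (s ^ p * D)) (𝓝[>] 1)
        (𝓝 (ENNReal.ofReal D)) := by
      have : Tendsto (fun s : ℝ => s ^ p * D) (𝓝 1) (𝓝 (1 ^ p * D)) :=
        ((tendsto_id).rpow_const (Or.inr hp0.le)).mul_const D
      rw [Real.one_rpow, one_mul] at this
      exact ENNReal.tendsto_ofReal (this.mono_left nhdsWithin_le_nhds)
    exact ge_of_tendsto ht (eventually_mem_nhdsWithin.mono fun s hs => key s hs)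

/-- Sharpened probability theoretic Hardy inequality (Theorem 1):
with `α ∈ [0,1]` the root of `E|ψ(Y)| (p-1+α) = p (E|ψ(Y)|^p)^{1/p} α^{1/p}`,
`{E(|E(ψ(Y)1_{Y≤X}|X)/F(X)|^p)}^{1/p} ≤ p/(p-1+α) {E(|ψ(Y)|^p)}^{1/p}`. -/
theorem probability_hardy_sharp {Ω : Type*} [MeasurableSpace Ω] (P : Measure Ω)
    [IsProbabilityMeasure P] (X Y : Ω → ℝ) (hX : Measurable X) (hY : Measurable Y)
    (hindep : IndepFun X Y P) (hid : Measure.map X P = Measure.map Y P)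
    (ψ : ℝ → ℝ) (hψ : Measurable ψ) (hne : ∃ y, ψ y ≠ 0) (p : ℝ) (hp : 1 < p)
    (hmom : ∫⁻ ω, ENNReal.ofReal (|ψ (Y ω)| ^ p) ∂P < ⊤)
    (α : ℝ) (hα : α ∈ Icc (0 : ℝ) 1)
    (hroot : (∫ ω, |ψ (Y ω)| ∂P) * (p - 1 + α)
        - p * (∫ ω, |ψ (Y ω)| ^ p ∂P) ^ (1 / p) * α ^ (1 / p) = 0) :
    (∫⁻ ω, ENNReal.ofReal
        (|(P[fun ω' => if Y ω' ≤ X ω' then ψ (Y ω') else 0 |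
            MeasurableSpace.comap X inferInstance]) ω /
          (Measure.map X P (Iic (X ω))).toReal| ^ p) ∂P) ^ (1 / p)
      ≤ ENNReal.ofReal (p / (p - 1 + α)) *
        (∫⁻ ω, ENNReal.ofReal (|ψ (Y ω)| ^ p) ∂P) ^ (1 / p) := by
  set μ := Measure.map X P with hμ
  have hprob : IsProbabilityMeasure μ := Measure.isProbabilityMeasure_map hX.aemeasurable
  have hp0 : 0 < p := by linarith
  have hfpm : Measurable fun y => |ψ y| ^ p := (by fun_prop : Measurable fun y => |ψ y|).pow_const p
  have hfm : Measurable fun y => |ψ y| := by fun_prop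
  have hmomμ : ∫⁻ ω, ENNReal.ofReal (|ψ (Y ω)| ^ p) ∂P
      = ∫⁻ y, ENNReal.ofReal (|ψ y| ^ p) ∂μ := by
    rw [hid, lintegral_map hfpm.ennreal_ofReal hY]
  have hfp : Integrable (fun y => |ψ y| ^ p) μ := by
    refine ⟨hfpm.aestronglyMeasurable, ?_⟩
    rw [hasFiniteIntegral_iff_ofReal (Eventually.of_forall fun y => by positivity), ← hmomμ]
    exact hmom
  have hf : Integrable (fun y => |ψ y|) μ := by
    refine ((integrable_const (1 : ℝ)).add hfp).mono' hfm.aestronglyMeasurable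
      (Eventually.of_forall fun y => ?_)
    simp only [Real.norm_eq_abs, abs_abs, Pi.add_apply]
    rcases le_total (|ψ y|) 1 with h | h
    · have : 0 ≤ |ψ y| ^ p := by positivity
      linarith
    · have := Real.self_le_rpow_of_one_le h hp.le
      linarith
  have hψi : Integrable ψ μ := by
    rw [← integrable_norm_iff hψ.aestronglyMeasurable]; exact hf
  have hi1 : ∫ ω, |ψ (Y ω)| ∂P = ∫ y, |ψ y| ∂μ := by
    rw [hid, integral_map hY.aemeasurable hfm.aestronglyMeasurable]
  have hi2 : ∫ ω, |ψ (Y ω)| ^ p ∂P = ∫ y, |ψ y| ^ p ∂μ := by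
    rw [hid, integral_map hY.aemeasurable hfpm.aestronglyMeasurable]
  rw [hi1, hi2] at hroot
  have hmain := hardy_main μ (fun y => abs_nonneg (ψ y)) hf hp hfp hα hroot
  -- the conditional expectation
  have hce : P[fun ω' => if Y ω' ≤ X ω' then ψ (Y ω') else 0 |
      MeasurableSpace.comap X inferInstance] =ᵐ[P] fun ω => ∫ y in Iic (X ω), ψ y ∂μ := by
    let g : ℝ × ℝ → ℝ := fun z => if z.2 ≤ z.1 then ψ z.2 else 0
    have hg : Measurable g := Measurable.ite (measurableSet_le measurable_snd measurable_fst)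
      (hψ.comp measurable_snd) measurable_const
    have hψY : Integrable (fun ω => ψ (Y ω)) P := by
      rw [hid] at hψi
      exact hψi.comp_measurable hY
    have hgi : Integrable (fun ω => g (X ω, Y ω)) P := by
      refine hψY.mono (hg.comp (hX.prodMk hY)).aestronglyMeasurable
        (Eventually.of_forall fun ω => ?_)
      simp only [g]
      split_ifs <;> simp
    have h1 := condExp_prod_ae_eq_integral_condDistrib hX hY.aemeasurable
      hg.stronglyMeasurable hgi
    have h2 : condDistrib Y X P =ᵐ[P.map X] Kernel.const ℝ μ := by
      refine condDistrib_ae_eq_of_measure_eq_compProd X hY.aemeasurable ?_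
      rw [Measure.compProd_const,
        (indepFun_iff_map_prod_eq_prod_map_map hX.aemeasurable hY.aemeasurable).1 hindep,
        ← hid]
    have h3 := ae_of_ae_map hX.aemeasurable h2
    refine h1.trans ?_
    filter_upwards [h3] with ω hω
    rw [hω, Kernel.const_apply, ← integral_indicator measurableSet_Iic]
    refine integral_congr_ae (Eventually.of_forall fun y => ?_)
    simp [g, indicator_apply]
  have hAm : Measurable fun x => ∫ y in Iic x, |ψ y| ∂μ := by
    refine Monotone.measurable fun x y hxy => ?_
    exact setIntegral_mono_set hf.integrableOn (Eventually.of_forall fun y => abs_nonneg _)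
      (Iic_subset_Iic.2 hxy).eventuallyLE
  have hFm : Measurable fun x => μ.real (Iic x) :=
    Monotone.measurable fun x y hxy => measureReal_mono (Iic_subset_Iic.2 hxy)
  have hle : ∫⁻ ω, ENNReal.ofReal
        (|(P[fun ω' => if Y ω' ≤ X ω' then ψ (Y ω') else 0 |
            MeasurableSpace.comap X inferInstance]) ω /
          (μ (Iic (X ω))).toReal| ^ p) ∂P ≤
      ∫⁻ x, ENNReal.ofReal (((∫ y in Iic x, |ψ y| ∂μ) / μ.real (Iic x)) ^ p) ∂μ := by
    have hmeas : Measurable fun x =>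
        ENNReal.ofReal (((∫ y in Iic x, |ψ y| ∂μ) / μ.real (Iic x)) ^ p) :=
      ((hAm.div hFm).pow_const p).ennreal_ofReal
    have hmap := lintegral_map (μ := P) hmeas hX
    rw [← hμ] at hmap
    rw [hmap]
    refine lintegral_mono_ae ?_
    filter_upwards [hce] with ω hω
    rw [hω]
    refine ENNReal.ofReal_le_ofReal (Real.rpow_le_rpow (abs_nonneg _) ?_ hp0.le)
    rw [abs_div, abs_of_nonneg (ENNReal.toReal_nonneg (a := μ (Iic (X ω))))]
    exact div_le_div_of_nonneg_right (abs_integral_le_integral_abs) ENNReal.toReal_nonneg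
  have hpa : 0 < p - 1 + α := by linarith [hα.1]
  have hq : 0 ≤ p / (p - 1 + α) := by positivity
  calc _ ≤ (ENNReal.ofReal ((p / (p - 1 + α)) ^ p * ∫ y, |ψ y| ^ p ∂μ)) ^ (1 / p) :=
        ENNReal.rpow_le_rpow (hle.trans hmain) (by positivity)
    _ = _ := by
        rw [ENNReal.ofReal_mul (by positivity), ENNReal.mul_rpow_of_nonneg _ _ (by positivity),
          ← ENNReal.ofReal_rpow_of_nonneg hq hp0.le, ← ENNReal.rpow_mul,
          mul_one_div_cancel hp0.ne', ENNReal.rpow_one, hmomμ,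
          ofReal_integral_eq_lintegral_ofReal hfp (Eventually.of_forall fun y => by positivity)]
end

section
/- Let $X$ and $Y$ be independent random variables with common distribution function $F$, let $0<p<1$, and let $\psi$ be a nonnegative measurable function. Then $\left\{E\left(\left(\frac{E(\psi(Y)\mathbf{1}_{[Y\ge X]}\mid X)}{F(X-)}\right)^p\right)\right\}^{1/p} \ge \frac{p}{1-p}\left\{E(\psi^p(Y))\right\}^{1/p}$. -/
open MeasureTheory Set ENNReal ProbabilityTheory

lemma aux_upset (ν : Measure ℝ) (S : Set ℝ) (hS : IsUpperSet S) (c : ℝ≥0∞)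
    (h : ∀ t ∈ S, ν (Ici t) ≤ c) : ν S ≤ c := by
  by_cases hl : ∃ a ∈ S, ∀ b ∈ S, a ≤ b
  · obtain ⟨a, ha, hb⟩ := hl
    exact (measure_mono (fun b hbS => hb b hbS)).trans (h a ha)
  · push Not at hl
    obtain ⟨T, hTS, hTc, hT⟩ := TopologicalSpace.isOpen_biUnion_countable S (fun t : ℝ => Ioi t)
      (fun _ _ => isOpen_Ioi)
    have hsub : S ⊆ ⋃ t ∈ T, Ioi t := by
      rw [hT]
      intro a ha
      obtain ⟨b, hb, hlt⟩ := hl a ha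
      exact mem_biUnion hb hlt
    refine (measure_mono hsub).trans ?_
    rw [measure_biUnion_eq_iSup hTc]
    · exact iSup₂_le fun t ht => (measure_mono Ioi_subset_Ici_self).trans (h t (hTS ht))
    · intro a ha b hb
      rcases le_total a b with hab | hab
      · exact ⟨a, ha, subset_rfl, Ioi_subset_Ioi hab⟩
      · exact ⟨b, hb, Ioi_subset_Ioi hab, subset_rfl⟩

lemma aux_dist1 (ν : Measure ℝ) (s : ℝ≥0∞) : ν {t | ν (Ici t) < s} ≤ s := by
  apply aux_upset
  · intro a b hab ha
    exact (measure_mono (Ici_subset_Ici.2 hab)).trans_lt ha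
  · intro t ht
    exact le_of_lt ht

lemma aux_dist2 (ν : Measure ℝ) [IsFiniteMeasure ν] (s : ℝ≥0∞) :
    min s (ν univ) ≤ ν {t | ν (Iio t) < s} := by
  rcases lt_or_ge (ν univ) s with hs | hs
  · have : {t | ν (Iio t) < s} = univ := by
      ext t
      simpa using (measure_mono (subset_univ _)).trans_lt hs
    rw [this]; exact min_le_right _ _
  · rw [min_eq_left hs]
    have hm : Monotone fun t => ν (Iio t) := fun a b hab => measure_mono (Iio_subset_Iio hab)
    have hmeas : MeasurableSet {t | ν (Iio t) < s} :=
      measurableSet_lt hm.measurable measurable_const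
    have h1 : ν {t | ν (Iio t) < s}ᶜ ≤ ν univ - s := by
      apply aux_upset
      · intro a b hab ha
        simp only [mem_compl_iff, mem_ofPred_eq, not_lt] at ha ⊢
        exact ha.trans (hm hab)
      · intro t ht
        simp only [mem_compl_iff, mem_ofPred_eq, not_lt] at ht
        rw [← compl_Iio, measure_compl measurableSet_Iio (measure_ne_top _ _)]
        exact tsub_le_tsub_left ht _
    have h2 := measure_add_measure_compl (μ := ν) hmeas
    have h3 : ν univ ≤ ν {t | ν (Iio t) < s} + (ν univ - s) := by
      rw [← h2]; gcongr; rw [h2]; exact h1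
    have h4 : s + (ν univ - s) = ν univ := add_tsub_cancel_of_le hs
    have h5 : ν univ - s ≠ ⊤ := (tsub_le_self.trans_lt (measure_lt_top ν _)).ne
    refine (ENNReal.add_le_add_iff_right h5).1 ?_
    rw [h4]; exact h3

lemma aux_layer_pos (q : ℝ) (hq : 0 < q) (z : ℝ) (hz : 0 < z) :
    ∫⁻ s in Ioi z, ENNReal.ofReal (q * s ^ (-q - 1)) = (ENNReal.ofReal z) ^ (-q) := by
  have hi : IntegrableOn (fun s : ℝ => s ^ (-q - 1)) (Ioi z) :=
    integrableOn_Ioi_rpow_of_lt (by linarith) hz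
  rw [← ofReal_integral_eq_lintegral_ofReal (hi.const_mul q), integral_const_mul,
    integral_Ioi_rpow_of_lt (by linarith) hz, ENNReal.ofReal_rpow_of_pos hz]
  · congr 1
    have : -q - 1 + 1 = -q := by ring
    rw [this]; field_simp
  · filter_upwards [ae_restrict_mem measurableSet_Ioi] with s hs
    have : 0 < s := hz.trans hs
    positivity

lemma aux_layer (q : ℝ) (hq : 0 < q) (z : ℝ≥0∞) :
    ∫⁻ s in Ioi (0:ℝ), ENNReal.ofReal (q * s ^ (-q - 1)) *
      {s : ℝ | z < ENNReal.ofReal s}.indicator 1 s = z ^ (-q) := by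
  have hpos : ∀ z : ℝ, 0 < z → ∫⁻ s in Ioi (0:ℝ), ENNReal.ofReal (q * s ^ (-q - 1)) *
      {s : ℝ | ENNReal.ofReal z < ENNReal.ofReal s}.indicator 1 s = (ENNReal.ofReal z) ^ (-q) := by
    intro z hz
    rw [← aux_layer_pos q hq z hz]
    have hset : {s : ℝ | ENNReal.ofReal z < ENNReal.ofReal s} = Ioi z := by
      ext s
      simp only [mem_ofPred_eq, mem_Ioi]
      constructor
      · intro h; exact (ENNReal.ofReal_lt_ofReal_iff_of_nonneg hz.le).1 h
      · intro h; exact (ENNReal.ofReal_lt_ofReal_iff_of_nonneg hz.le).2 h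
    rw [hset]
    have : ∀ s : ℝ, ENNReal.ofReal (q * s ^ (-q - 1)) * (Ioi z).indicator 1 s
        = (Ioi z).indicator (fun s => ENNReal.ofReal (q * s ^ (-q - 1))) s := by
      intro s
      by_cases h : s ∈ Ioi z <;> simp [h]
    simp_rw [this]
    rw [lintegral_indicator measurableSet_Ioi, Measure.restrict_restrict measurableSet_Ioi]
    congr 2
    rw [inter_eq_left]
    exact Ioi_subset_Ioi hz.le
  rcases eq_or_ne z ⊤ with rfl | hzt
  · simp [hq]
  rcases eq_or_ne z 0 with rfl | hz0
  · rw [ENNReal.zero_rpow_of_neg (by linarith)]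
    rw [eq_top_iff]
    refine ENNReal.le_of_forall_nnreal_lt fun r _ => ?_
    set w : ℝ := ((r : ℝ) + 1) ^ (-(1/q)) with hw
    have hw0 : 0 < w := by positivity
    have hwr : (ENNReal.ofReal w) ^ (-q) = ENNReal.ofReal (r + 1) := by
      rw [ENNReal.ofReal_rpow_of_pos hw0, hw, ← Real.rpow_mul (by positivity)]
      congr 1
      have : -(1/q) * -q = 1 := by field_simp
      rw [this, Real.rpow_one]
    calc (r : ℝ≥0∞) = ENNReal.ofReal r := by simp
      _ ≤ ENNReal.ofReal (r + 1) := ENNReal.ofReal_le_ofReal (by linarith)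
      _ = _ := hwr.symm
      _ = _ := (hpos w hw0).symm
      _ ≤ _ := by
        refine lintegral_mono fun s => ?_
        gcongr
        exact zero_le
  · have h := hpos z.toReal (ENNReal.toReal_pos hz0 hzt)
    rwa [ENNReal.ofReal_toReal hzt] at h

lemma aux_K {α : Type*} [MeasurableSpace α] (μ : Measure α) [SFinite μ] (a : α → ℝ≥0∞)
    (ha : Measurable a) (q : ℝ) (hq : 0 < q) :
    ∫⁻ x, a x ^ (-q) ∂μ = ∫⁻ s in Ioi (0:ℝ), ENNReal.ofReal (q * s ^ (-q - 1)) *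
      μ {x | a x < ENNReal.ofReal s} := by
  simp_rw [← aux_layer q hq (a _)]
  rw [lintegral_lintegral_swap]
  · refine lintegral_congr fun s => ?_
    have hm : MeasurableSet {x | a x < ENNReal.ofReal s} := measurableSet_lt ha measurable_const
    rw [lintegral_const_mul _ ?_]
    · congr 1
      rw [← lintegral_indicator_one hm]
      rfl
    · exact (measurable_one.indicator hm)
  · refine Measurable.aemeasurable ?_
    have hm : MeasurableSet {z : α × ℝ | a z.1 < ENNReal.ofReal z.2} :=
      measurableSet_lt (by fun_prop) (by fun_prop)
    have : Measurable ({z : α × ℝ | a z.1 < ENNReal.ofReal z.2}.indicator (1 : α × ℝ → ℝ≥0∞)) :=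
      measurable_one.indicator hm
    refine Measurable.mul (by fun_prop) this

lemma aux_vol (q : ℝ) (hq0 : 0 < q) (hq1 : q < 1) (M : ℝ) (hM : 0 ≤ M) :
    ∫⁻ s in Ioi (0:ℝ), ENNReal.ofReal (q * s ^ (-q - 1)) *
      min (ENNReal.ofReal s) (ENNReal.ofReal M)
      = ENNReal.ofReal (1 / (1 - q)) * (ENNReal.ofReal M) ^ (1 - q) := by
  have h := aux_K (volume.restrict (Ioc (0:ℝ) M)) ENNReal.ofReal ENNReal.measurable_ofReal q hq0
  have h1 : ∫⁻ s in Ioi (0:ℝ), ENNReal.ofReal (q * s ^ (-q - 1)) *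
      min (ENNReal.ofReal s) (ENNReal.ofReal M) = ∫⁻ s in Ioi (0:ℝ),
      ENNReal.ofReal (q * s ^ (-q - 1)) *
      (volume.restrict (Ioc (0:ℝ) M)) {x | ENNReal.ofReal x < ENNReal.ofReal s} := by
    refine setLIntegral_congr_fun measurableSet_Ioi fun s hs => ?_
    have hs : 0 < s := hs
    congr 1
    rw [Measure.restrict_apply (measurableSet_lt (by fun_prop) (by fun_prop))]
    have : {x | ENNReal.ofReal x < ENNReal.ofReal s} = Iio s := by
      ext x; simp [ENNReal.ofReal_lt_ofReal_iff hs]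
    rw [this]
    rcases lt_or_ge M s with hMs | hMs
    · rw [min_eq_right (ENNReal.ofReal_le_ofReal hMs.le)]
      rw [inter_eq_right.2]
      · simp
      · intro x hx; exact hx.2.trans_lt hMs
    · rw [min_eq_left (ENNReal.ofReal_le_ofReal hMs)]
      have : Iio s ∩ Ioc 0 M = Ioo 0 s := by
        ext x; simp only [mem_inter_iff, mem_Iio, mem_Ioc, mem_Ioo]
        constructor
        · rintro ⟨a, b, c⟩; exact ⟨b, a⟩
        · rintro ⟨a, b⟩; exact ⟨b, a, by linarith⟩
      rw [this]; simp
  rw [h1, ← h]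
  have h2 : ∫⁻ x in Ioc 0 M, ENNReal.ofReal x ^ (-q) = ∫⁻ x in Ioc 0 M, ENNReal.ofReal (x ^ (-q)) :=
    setLIntegral_congr_fun measurableSet_Ioc fun x hx => ENNReal.ofReal_rpow_of_pos hx.1
  have hi : IntervalIntegrable (fun x : ℝ => x ^ (-q)) volume 0 M :=
    intervalIntegral.intervalIntegrable_rpow' (by linarith)
  rw [h2, ← ofReal_integral_eq_lintegral_ofReal, ← intervalIntegral.integral_of_le hM,
    integral_rpow (Or.inl (by linarith)), ENNReal.ofReal_rpow_of_nonneg hM (by linarith),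
    ← ENNReal.ofReal_mul (by have : 0 < 1 - q := by linarith
                             positivity)]
  · congr 1
    have : -q + 1 = 1 - q := by ring
    rw [this, Real.zero_rpow (by linarith)]; ring
  · exact (intervalIntegrable_iff_integrableOn_Ioc_of_le hM).1 hi
  · filter_upwards [ae_restrict_mem measurableSet_Ioc] with s hs
    have := hs.1
    positivity

lemma aux_meas_Ici (ν : Measure ℝ) : Measurable fun t => ν (Ici t) :=
  Antitone.measurable fun _ _ hab => measure_mono (Ici_subset_Ici.2 hab)

lemma aux_meas_Iio (ν : Measure ℝ) : Measurable fun t => ν (Iio t) :=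
  Monotone.measurable fun _ _ hab => measure_mono (Iio_subset_Iio hab)

lemma aux_1 (ν : Measure ℝ) (hν : ν univ ≠ ⊤) (q : ℝ) (hq0 : 0 < q) (hq1 : q < 1) :
    ∫⁻ t, ν (Ici t) ^ (-q) ∂ν ≤ ENNReal.ofReal (1 / (1 - q)) * ν univ ^ (1 - q) := by
  have : IsFiniteMeasure ν := ⟨hν.lt_top⟩
  rw [aux_K ν _ (aux_meas_Ici ν) q hq0]
  have := aux_vol q hq0 hq1 (ν univ).toReal ENNReal.toReal_nonneg
  rw [ENNReal.ofReal_toReal hν] at this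
  rw [← this]
  refine lintegral_mono fun s => ?_
  gcongr
  exact le_min (aux_dist1 ν _) (measure_mono (subset_univ _))

lemma aux_2 (ν : Measure ℝ) [IsFiniteMeasure ν] (q : ℝ) (hq0 : 0 < q) (hq1 : q < 1) :
    ENNReal.ofReal (1 / (1 - q)) * ν univ ^ (1 - q) ≤ ∫⁻ t, ν (Iio t) ^ (-q) ∂ν := by
  rw [aux_K ν _ (aux_meas_Iio ν) q hq0]
  have := aux_vol q hq0 hq1 (ν univ).toReal ENNReal.toReal_nonneg
  rw [ENNReal.ofReal_toReal (measure_ne_top _ _)] at this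
  rw [← this]
  refine lintegral_mono fun s => ?_
  gcongr
  exact aux_dist2 ν _

lemma aux_1' (ν : Measure ℝ) (x : ℝ) (p : ℝ) (hp0 : 0 < p) (hp1 : p < 1) :
    ENNReal.ofReal p * ∫⁻ t in Ici x, ν (Ici t) ^ (p - 1) ∂ν ≤ ν (Ici x) ^ p := by
  rcases eq_or_ne (ν (Ici x)) ⊤ with h | h
  · rw [h, ENNReal.top_rpow_of_pos hp0]; exact le_top
  have h1 := aux_1 (ν.restrict (Ici x)) (by simpa using h) (1 - p) (by linarith) (by linarith)
  have h2 : ∫⁻ t in Ici x, ν (Ici t) ^ (p - 1) ∂ν =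
      ∫⁻ t in Ici x, (ν.restrict (Ici x)) (Ici t) ^ (-(1 - p)) ∂ν := by
    refine setLIntegral_congr_fun measurableSet_Ici fun t ht => ?_
    have : Ici t ∩ Ici x = Ici t := inter_eq_left.2 (Ici_subset_Ici.2 ht)
    simp only [Measure.restrict_apply measurableSet_Ici, this, neg_sub]
  rw [h2]
  calc _ ≤ ENNReal.ofReal p * (ENNReal.ofReal (1 / (1 - (1 - p))) *
        (ν.restrict (Ici x)) univ ^ (1 - (1 - p))) := by gcongr
    _ = _ := by
      rw [← mul_assoc, ← ENNReal.ofReal_mul hp0.le]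
      have e : p * (1 / (1 - (1 - p))) = 1 := by
        have : 1 - (1 - p) = p := by ring
        rw [this]; field_simp
      rw [e]; simp

lemma aux_2' (μ : Measure ℝ) [IsFiniteMeasure μ] (t : ℝ) (p : ℝ) (hp0 : 0 < p) (hp1 : p < 1) :
    ENNReal.ofReal (1 / (1 - p)) * μ (Iio t) ^ (1 - p) ≤
      ∫⁻ x in Iic t, μ (Iio x) ^ (-p) ∂μ := by
  have h1 := aux_2 (μ.restrict (Iic t)) p hp0 hp1
  have h2 : ∫⁻ x in Iic t, μ (Iio x) ^ (-p) ∂μ =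
      ∫⁻ x in Iic t, (μ.restrict (Iic t)) (Iio x) ^ (-p) ∂μ := by
    refine setLIntegral_congr_fun measurableSet_Iic fun x hx => ?_
    have : Iio x ∩ Iic t = Iio x := inter_eq_left.2 fun y hy => mem_Iic.2 ((le_of_lt (mem_Iio.1 hy)).trans (mem_Iic.1 hx))
    simp only [Measure.restrict_apply measurableSet_Iio, this]
  rw [h2]
  refine le_trans ?_ h1
  rw [Measure.restrict_apply_univ]
  have : 0 ≤ 1 - p := by linarith
  gcongr
  exact Iio_subset_Iic_self

lemma aux_main (μ : Measure ℝ) [IsProbabilityMeasure μ] (f : ℝ → ℝ≥0∞) (hf : Measurable f)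
    (p : ℝ) (hp0 : 0 < p) (hp1 : p < 1) :
    ENNReal.ofReal (p / (1 - p)) ^ p * ∫⁻ t, f t ^ p ∂μ ≤
      ∫⁻ x, ((∫⁻ y in Ici x, f y ∂μ) / μ (Iio x)) ^ p ∂μ := by
  have hq0 : 0 < 1 - p := by linarith
  obtain ⟨ν, hν⟩ : ∃ ν, ν = μ.withDensity f := ⟨_, rfl⟩
  have hG : ∀ x, ∫⁻ y in Ici x, f y ∂μ = ν (Ici x) := fun x => by
    rw [hν, withDensity_apply f measurableSet_Ici]
  simp_rw [hG]
  set A := ∫⁻ x, (ν (Ici x) / μ (Iio x)) ^ p ∂μ with hA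
  rcases eq_or_ne A ⊤ with hAt | hAt
  · rw [hAt]; exact le_top
  have mG := aux_meas_Ici ν
  have mH := aux_meas_Iio μ
  have mGp : Measurable fun t => ν (Ici t) ^ (p - 1) := mG.pow_const _
  have mHp : Measurable fun t => μ (Iio t) ^ (1 - p) := mH.pow_const _
  have mHn : Measurable fun t => μ (Iio t) ^ (-p) := mH.pow_const _
  have mB : Measurable fun t => f t * (ν (Ici t) ^ (p - 1) * μ (Iio t) ^ (1 - p)) :=
    hf.mul (mGp.mul mHp)
  have mA : Measurable fun t => (ν (Ici t) / μ (Iio t)) ^ p := (mG.div mH).pow_const _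
  set B := ∫⁻ t, f t * (ν (Ici t) ^ (p - 1) * μ (Iio t) ^ (1 - p)) ∂μ with hB
  have hBA : ENNReal.ofReal (p / (1 - p)) * B ≤ A := by
    have hm : MeasurableSet {z : ℝ × ℝ | z.1 ≤ z.2} := measurableSet_le measurable_fst measurable_snd
    have hA1 : A = ∫⁻ x, μ (Iio x) ^ (-p) * ν (Ici x) ^ p ∂μ := by
      refine lintegral_congr fun x => ?_
      rw [div_eq_mul_inv, ENNReal.mul_rpow_of_nonneg _ _ hp0.le, ENNReal.inv_rpow,
        ENNReal.rpow_neg, mul_comm]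
    have e1 : ∀ x, ∫⁻ t in Ici x, ν (Ici t) ^ (p - 1) ∂ν =
        ∫⁻ t, {z : ℝ × ℝ | z.1 ≤ z.2}.indicator (fun z => f z.2 * ν (Ici z.2) ^ (p - 1)) (x, t) ∂μ := by
      intro x
      have h3 := setLIntegral_withDensity_eq_setLIntegral_mul μ hf (mG.pow_const (p - 1))
        (measurableSet_Ici (a := x))
      rw [← hν] at h3
      rw [h3, ← lintegral_indicator measurableSet_Ici]
      rfl
    have mI : Measurable ({z : ℝ × ℝ | z.1 ≤ z.2}.indicator
        (fun z => f z.2 * ν (Ici z.2) ^ (p - 1))) := by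
      refine Measurable.indicator ?_ hm
      exact (hf.comp measurable_snd).mul ((mG.comp measurable_snd).pow_const _)
    calc ENNReal.ofReal (p / (1 - p)) * B
        = ENNReal.ofReal p * ∫⁻ t, f t * ν (Ici t) ^ (p - 1) *
            (ENNReal.ofReal (1 / (1 - p)) * μ (Iio t) ^ (1 - p)) ∂μ := by
          rw [div_eq_mul_one_div p, ENNReal.ofReal_mul hp0.le, mul_assoc, hB,
            ← lintegral_const_mul _ mB]
          congr 1
          refine lintegral_congr fun t => ?_
          ring
      _ ≤ ENNReal.ofReal p * ∫⁻ t, f t * ν (Ici t) ^ (p - 1) *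
            (∫⁻ x in Iic t, μ (Iio x) ^ (-p) ∂μ) ∂μ := by
          gcongr with t
          exact aux_2' μ t p hp0 hp1
      _ = ENNReal.ofReal p * ∫⁻ t, ∫⁻ x, μ (Iio x) ^ (-p) * {z : ℝ × ℝ | z.1 ≤ z.2}.indicator
            (fun z => f z.2 * ν (Ici z.2) ^ (p - 1)) (x, t) ∂μ ∂μ := by
          congr 1
          refine lintegral_congr fun t => ?_
          rw [← lintegral_const_mul _ mHn, ← lintegral_indicator measurableSet_Iic]
          refine lintegral_congr fun x => ?_
          by_cases hx : x ≤ t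
          · simp [hx, mul_comm]
          · simp [hx]
      _ = ENNReal.ofReal p * ∫⁻ x, ∫⁻ t, μ (Iio x) ^ (-p) * {z : ℝ × ℝ | z.1 ≤ z.2}.indicator
            (fun z => f z.2 * ν (Ici z.2) ^ (p - 1)) (x, t) ∂μ ∂μ := by
          rw [lintegral_lintegral_swap]
          refine Measurable.aemeasurable ?_
          refine Measurable.mul ?_ ?_
          · exact (mH.comp measurable_snd).pow_const _
          · exact mI.comp measurable_swap
      _ = ∫⁻ x, μ (Iio x) ^ (-p) *
            (ENNReal.ofReal p * ∫⁻ t in Ici x, ν (Ici t) ^ (p - 1) ∂ν) ∂μ := by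
          rw [← lintegral_const_mul' _ _ ENNReal.ofReal_ne_top]
          refine lintegral_congr fun x => ?_
          have mIx : Measurable fun t => {z : ℝ × ℝ | z.1 ≤ z.2}.indicator
            (fun z => f z.2 * ν (Ici z.2) ^ (p - 1)) (x, t) := mI.comp measurable_prodMk_left
          rw [e1, lintegral_const_mul _ mIx]
          ring
      _ ≤ A := by
          rw [hA1]
          gcongr with x
          exact aux_1' ν x p hp0 hp1
  have hnull : ∀ᵐ t ∂μ, ν (Ici t) = 0 → f t = 0 := by
    have h0 : ν {t | ν (Ici t) = 0} = 0 := by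
      refine le_antisymm (aux_upset ν _ ?_ 0 ?_) zero_le
      · intro a b hab ha
        exact le_antisymm ((measure_mono (Ici_subset_Ici.2 hab)).trans (le_of_eq ha)) zero_le
      · intro t ht; exact le_of_eq ht
    have hm0 : MeasurableSet {t | ν (Ici t) = 0} := mG (measurableSet_singleton 0)
    have h3 := withDensity_apply f hm0 (μ := μ)
    rw [← hν, h0] at h3
    have h0 := (lintegral_eq_zero_iff hf).1 h3.symm
    exact (ae_restrict_iff' hm0).1 h0
  have hfin : ∀ᵐ t ∂μ, (ν (Ici t) / μ (Iio t)) ^ p < ⊤ :=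
    ae_lt_top mA hAt
  have hholder : ∫⁻ t, f t ^ p ∂μ ≤ B ^ p * A ^ (1 - p) := by
    refine le_trans ?_ (ENNReal.lintegral_mul_norm_pow_le (μ := μ)
      (f := fun t => f t * (ν (Ici t) ^ (p - 1) * μ (Iio t) ^ (1 - p)))
      (g := fun t => (ν (Ici t) / μ (Iio t)) ^ p) mB.aemeasurable mA.aemeasurable hp0.le hq0.le
      (by ring))
    refine lintegral_mono_ae ?_
    filter_upwards [hnull, hfin] with t h1 h2
    by_cases hft : f t = 0
    · rw [hft, ENNReal.zero_rpow_of_pos hp0]; exact zero_le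
    have hG0 : ν (Ici t) ≠ 0 := fun h => hft (h1 h)
    have hdiv : ν (Ici t) / μ (Iio t) ≠ ⊤ := by
      intro h
      rw [h, ENNReal.top_rpow_of_pos hp0] at h2
      exact lt_irrefl _ h2
    have hHt : μ (Iio t) ≠ ⊤ := measure_ne_top _ _
    have hH0 : μ (Iio t) ≠ 0 := by
      intro h; rw [h] at hdiv; exact hdiv (ENNReal.div_zero hG0)
    have hGt : ν (Ici t) ≠ ⊤ := by
      intro h; rw [h] at hdiv; exact hdiv (ENNReal.top_div_of_ne_top hHt)
    generalize ν (Ici t) = G at *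
    generalize μ (Iio t) = H at *
    refine le_of_eq ?_
    have key : (G ^ (p - 1) * H ^ (1 - p)) ^ p * ((G / H) ^ p) ^ (1 - p) = 1 := by
      have : G ^ (p - 1) * H ^ (1 - p) = (G / H) ^ (-(1 - p)) := by
        rw [ENNReal.rpow_neg, ENNReal.div_rpow_of_nonneg _ _ hq0.le, ENNReal.inv_div
          (Or.inr (ENNReal.rpow_ne_top_of_nonneg hq0.le hGt)) (Or.inr (by
            simp [ENNReal.rpow_eq_zero_iff, hG0, hGt])), div_eq_mul_inv, ← ENNReal.rpow_neg, neg_sub,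
          mul_comm]
      rw [this, ← ENNReal.rpow_mul, ← ENNReal.rpow_mul, ← ENNReal.rpow_add _ _ ?_ hdiv]
      · have : -(1 - p) * p + p * (1 - p) = 0 := by ring
        rw [this, ENNReal.rpow_zero]
      · simp [ENNReal.div_eq_zero_iff, hG0, hHt]
    rw [ENNReal.mul_rpow_of_nonneg _ _ hp0.le, mul_assoc, key, mul_one]
  calc ENNReal.ofReal (p / (1 - p)) ^ p * ∫⁻ t, f t ^ p ∂μ
      ≤ ENNReal.ofReal (p / (1 - p)) ^ p * (B ^ p * A ^ (1 - p)) := by gcongr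
    _ = (ENNReal.ofReal (p / (1 - p)) * B) ^ p * A ^ (1 - p) := by
        rw [ENNReal.mul_rpow_of_nonneg _ _ hp0.le, mul_assoc]
    _ ≤ A ^ p * A ^ (1 - p) := by gcongr
    _ = A := by
        rw [← ENNReal.rpow_add_of_nonneg _ _ hp0.le hq0.le]; simp

/-- Probability theoretic reversed Hardy inequality for `0 < p < 1` (Theorem 2).
The conditional expectation `E(ψ(Y)1_{Y≥X} | X)` is written explicitly, via independence,
as `∫_{[X,∞)} ψ dμ` with `μ` the common law; `F(X-) = μ(Iio X)`; the ratio is `∞` when the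
denominator vanishes and the numerator is positive. -/
theorem probability_hardy_reversed {Ω : Type*} [MeasurableSpace Ω] (P : Measure Ω)
    [IsProbabilityMeasure P] (X Y : Ω → ℝ) (hX : Measurable X) (hY : Measurable Y)
    (hindep : IndepFun X Y P) (hid : Measure.map X P = Measure.map Y P)
    (ψ : ℝ → ℝ) (hψ : Measurable ψ) (hpos : ∀ y, 0 ≤ ψ y)
    (p : ℝ) (hp0 : 0 < p) (hp1 : p < 1) :
    (∫⁻ ω, ((∫⁻ y in Ici (X ω), ENNReal.ofReal (ψ y) ∂(Measure.map Y P)) /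
        Measure.map Y P (Iio (X ω))) ^ p ∂P) ^ (1 / p)
      ≥ ENNReal.ofReal (p / (1 - p)) *
        (∫⁻ ω, ENNReal.ofReal (ψ (Y ω)) ^ p ∂P) ^ (1 / p) := by
  have : IsProbabilityMeasure (Measure.map Y P) := Measure.isProbabilityMeasure_map hY.aemeasurable
  have hf : Measurable fun y => ENNReal.ofReal (ψ y) := hψ.ennreal_ofReal
  have h := aux_main (Measure.map Y P) (fun y => ENNReal.ofReal (ψ y)) hf p hp0 hp1
  have hR : ∫⁻ ω, ENNReal.ofReal (ψ (Y ω)) ^ p ∂P =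
      ∫⁻ t, ENNReal.ofReal (ψ t) ^ p ∂(Measure.map Y P) :=
    (lintegral_map (hf.pow_const p) hY).symm
  have mG : Measurable fun x => ∫⁻ y in Ici x, ENNReal.ofReal (ψ y) ∂(Measure.map Y P) :=
    Antitone.measurable fun a b hab => lintegral_mono_set (Ici_subset_Ici.2 hab)
  have hL : ∫⁻ ω, ((∫⁻ y in Ici (X ω), ENNReal.ofReal (ψ y) ∂(Measure.map Y P)) /
        Measure.map Y P (Iio (X ω))) ^ p ∂P =
      ∫⁻ x, ((∫⁻ y in Ici x, ENNReal.ofReal (ψ y) ∂(Measure.map Y P)) /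
        Measure.map Y P (Iio x)) ^ p ∂(Measure.map Y P) := by
    conv_rhs => rw [← hid]
    rw [lintegral_map _ hX]
    · simp only [hid]
    · rw [hid]
      exact (mG.div (aux_meas_Iio _)).pow_const p
  rw [hR, hL, ge_iff_le]
  have h2 := ENNReal.rpow_le_rpow h (by positivity : 0 ≤ 1 / p)
  refine le_trans (le_of_eq ?_) h2
  rw [ENNReal.mul_rpow_of_nonneg _ _ (by positivity), ← ENNReal.rpow_mul,
    mul_one_div_cancel hp0.ne', ENNReal.rpow_one]
end
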